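/- arXiv:2112.13245 — 2 statements merged into one kernel-verified Lean document; each statement's English description precedes it below -/
import Mathlib

section
/- Suppose max_{1≤i≤m} n_i ≥ 2. Then for every parameter λ (all λ_{i,j} > 0), R(λ^O, λ) < R(λ^ML, λ); that is, in the multi-group model the estimator λ^O strictly dominates the maximum likelihood estimator λ^ML under the standardized squared error loss. -/
open scoped BigOperators ENNReal

/-- The Poisson(μ) probability of the value `k`. -/
noncomputable def poissonPmf (mu : ℝ) (k : ℕ) : ℝ :=
  mu ^ k * Real.exp (-mu) / (Nat.factorial k)

/-- Joint pmf of the multi-group observations: the X_{i,j} ~ Po(λ_{i,j}) and the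
Y_i ~ Po(λ_{i·}) are all independent. -/
noncomputable def jointPmf2 (m : ℕ) (n : Fin m → ℕ) (lam : (i : Fin m) → Fin (n i) → ℝ)
    (x : (i : Fin m) → Fin (n i) → ℕ) (y : Fin m → ℕ) : ℝ :=
  ∏ i, (poissonPmf (∑ j, lam i j) (y i) * ∏ j, poissonPmf (lam i j) (x i j))

/-- Risk under the standardized squared error loss, valued in [0,∞]. -/
noncomputable def risk2 (m : ℕ) (n : Fin m → ℕ)
    (δ : ((i : Fin m) → Fin (n i) → ℕ) → (Fin m → ℕ) → (i : Fin m) → Fin (n i) → ℝ)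
    (lam : (i : Fin m) → Fin (n i) → ℝ) : ℝ≥0∞ :=
  ∑' x : (i : Fin m) → Fin (n i) → ℕ, ∑' y : Fin m → ℕ,
    ENNReal.ofReal ((∑ i, ∑ j, (δ x y i j - lam i j) ^ 2 / lam i j) * jointPmf2 m n lam x y)

/-- The maximum likelihood estimator λ^ML_{i,j} = ((X_{i·}+Y_i)/2)·X_{i,j}/X_{i·}
(with the convention 0/0 = 0, which is Lean's division by zero). -/
noncomputable def estML2 (m : ℕ) (n : Fin m → ℕ)
    (x : (i : Fin m) → Fin (n i) → ℕ) (y : Fin m → ℕ) (i : Fin m) (j : Fin (n i)) : ℝ :=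
  ((∑ k, (x i k : ℝ)) + (y i : ℝ)) / 2 * ((x i j : ℝ) / ∑ k, (x i k : ℝ))

/-- The estimator λ^O_{i,j} = ((X_{i·}+Y_i+n_i−1)/2)·X_{i,j}/(X_{i·}+n_i−1). -/
noncomputable def estO2 (m : ℕ) (n : Fin m → ℕ)
    (x : (i : Fin m) → Fin (n i) → ℕ) (y : Fin m → ℕ) (i : Fin m) (j : Fin (n i)) : ℝ :=
  ((∑ k, (x i k : ℝ)) + (y i : ℝ) + (n i : ℝ) - 1) / 2 *
    ((x i j : ℝ) / ((∑ k, (x i k : ℝ)) + (n i : ℝ) - 1))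

theorem tsum_pi_prod_eq_prod_tsum {m : ℕ} {α : Fin m → Type*} (f : (i : Fin m) → α i → ℝ≥0∞) :
    ∑' x : (i : Fin m) → α i, ∏ i, f i (x i) = ∏ i, ∑' a, f i a := by
  induction m with
  | zero => simp
  | succ m ih =>
    rw [← (Fin.consEquiv α).tsum_eq, ENNReal.tsum_prod', Fin.prod_univ_succ,
      ← ih (fun i => f i.succ), ← ENNReal.tsum_mul_right]
    refine tsum_congr fun a => ?_
    rw [← ENNReal.tsum_mul_left]
    refine tsum_congr fun x => ?_
    simp [Fin.consEquiv, Fin.prod_univ_succ]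

theorem poissonPmf_nonneg {mu : ℝ} (hmu : 0 ≤ mu) (k : ℕ) : 0 ≤ poissonPmf mu k := by
  unfold poissonPmf; positivity

theorem poissonPmf_pos {mu : ℝ} (hmu : 0 < mu) (k : ℕ) : 0 < poissonPmf mu k := by
  unfold poissonPmf; positivity

theorem succ_mul_poissonPmf_succ (mu : ℝ) (k : ℕ) :
    ((k : ℝ) + 1) * poissonPmf mu (k + 1) = mu * poissonPmf mu k := by
  unfold poissonPmf
  rw [Nat.factorial_succ]
  push_cast
  field_simp
  ring

theorem sum_antidiagonal_poissonPmf (a b : ℝ) (s : ℕ) :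
    ∑ p ∈ Finset.HasAntidiagonal.antidiagonal s, poissonPmf a p.1 * poissonPmf b p.2 =
      poissonPmf (a + b) s := by
  unfold poissonPmf
  rw [(Commute.all a b).add_pow', neg_add, Real.exp_add, Finset.sum_mul, Finset.sum_div]
  refine Finset.sum_congr rfl fun p hp => ?_
  obtain rfl := Finset.HasAntidiagonal.mem_antidiagonal.1 hp
  have h := Nat.add_choose_mul_factorial_mul_factorial p.1 p.2
  have h' : ((p.1 + p.2).choose p.1 : ℝ) * p.1.factorial * p.2.factorial =
      (p.1 + p.2).factorial := by
    rw [← h, Nat.choose_symm_add]; push_cast; ring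
  rw [nsmul_eq_mul, ← h']
  have := Nat.choose_pos (Nat.le_add_right p.1 p.2)
  field_simp

theorem hasSum_poissonPmf (mu : ℝ) : HasSum (poissonPmf mu) 1 := by
  have h := (NormedSpace.expSeries_div_hasSum_exp mu).mul_right (Real.exp (-mu))
  rw [← Real.exp_eq_exp_ℝ, ← Real.exp_add, add_neg_cancel, Real.exp_zero] at h
  refine h.congr_fun fun k => ?_
  unfold poissonPmf
  ring

theorem hasSum_id_mul_poissonPmf (mu : ℝ) : HasSum (fun k : ℕ => (k : ℝ) * poissonPmf mu k) mu := by
  rw [← hasSum_nat_add_iff' 1]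
  simpa [succ_mul_poissonPmf_succ] using (hasSum_poissonPmf mu).mul_left mu

theorem hasSum_sq_mul_poissonPmf (mu : ℝ) :
    HasSum (fun k : ℕ => (k : ℝ) ^ 2 * poissonPmf mu k) (mu ^ 2 + mu) := by
  rw [← hasSum_nat_add_iff' 1]
  have h := ((hasSum_id_mul_poissonPmf mu).add (hasSum_poissonPmf mu)).mul_left mu
  convert! h using 1
  · funext k
    have := succ_mul_poissonPmf_succ mu k
    push_cast
    linear_combination ((k : ℝ) + 1) * this
  · simp; ring

theorem hasSum_quadratic_mul_poissonPmf (mu A B C : ℝ) :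
    HasSum (fun k : ℕ => (A + B * k + C * (k : ℝ) ^ 2) * poissonPmf mu k)
      (A + B * mu + C * (mu ^ 2 + mu)) := by
  have h := (((hasSum_poissonPmf mu).mul_left A).add
    ((hasSum_id_mul_poissonPmf mu).mul_left B)).add ((hasSum_sq_mul_poissonPmf mu).mul_left C)
  convert! h using 1
  · funext k; ring
  · ring

/-- The Poisson probabilities as extended nonnegative reals. -/
noncomputable def poissonWeight (mu : ℝ) (k : ℕ) : ℝ≥0∞ := ENNReal.ofReal (poissonPmf mu k)

theorem tsum_poissonWeight_mul_add {a b : ℝ} (ha : 0 ≤ a) (hb : 0 ≤ b) (f : ℕ → ℝ≥0∞) :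
    ∑' k, poissonWeight a k * ∑' l, poissonWeight b l * f (k + l) =
      ∑' s, poissonWeight (a + b) s * f s := by
  simp_rw [← ENNReal.tsum_mul_left]
  rw [← ENNReal.tsum_prod (f := fun k l => poissonWeight a k * (poissonWeight b l * f (k + l))),
    ← Finset.HasAntidiagonal.sigmaAntidiagonalEquivProd.tsum_eq, ENNReal.tsum_sigma']
  refine tsum_congr fun s => ?_
  rw [tsum_fintype, poissonWeight.eq_def (a + b), ← sum_antidiagonal_poissonPmf,
    ENNReal.ofReal_sum_of_nonneg
      fun p _ => mul_nonneg (poissonPmf_nonneg ha _) (poissonPmf_nonneg hb _),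
    Finset.sum_mul, ← Finset.sum_coe_sort (Finset.HasAntidiagonal.antidiagonal s)]
  refine Finset.sum_congr rfl fun p _ => ?_
  have hp := Finset.HasAntidiagonal.mem_antidiagonal.1 p.2
  simp [Finset.HasAntidiagonal.sigmaAntidiagonalEquivProd, hp, poissonWeight,
    ENNReal.ofReal_mul (poissonPmf_nonneg ha _), mul_assoc]

theorem tsum_pi_fin_succ {n : ℕ} (f : (Fin (n + 1) → ℕ) → ℝ≥0∞) :
    ∑' u, f u = ∑' a, ∑' u : Fin n → ℕ, f (Fin.cons a u) := by
  rw [← (Fin.consEquiv fun _ : Fin (n + 1) => ℕ).tsum_eq, ENNReal.tsum_prod']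
  rfl

theorem tsum_prod_poissonWeight_mul {n : ℕ} (lam : Fin n → ℝ) (hlam : ∀ j, 0 ≤ lam j)
    (f : ℕ → ℝ≥0∞) :
    ∑' u : Fin n → ℕ, (∏ j, poissonWeight (lam j) (u j)) * f (∑ j, u j) =
      ∑' s, poissonWeight (∑ j, lam j) s * f s := by
  induction n generalizing f with
  | zero =>
    rw [tsum_eq_single (β := ℕ) 0 fun s hs => by simp [poissonWeight, poissonPmf, hs]]
    simp [poissonWeight, poissonPmf]
  | succ n ih =>
    rw [tsum_pi_fin_succ, Fin.sum_univ_succ,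
      ← tsum_poissonWeight_mul_add (hlam 0) (Finset.sum_nonneg fun j _ => hlam j.succ)]
    refine tsum_congr fun a => ?_
    rw [← ih _ (fun j => hlam j.succ), ← ENNReal.tsum_mul_left]
    refine tsum_congr fun u => ?_
    simp [Fin.prod_univ_succ, Fin.sum_univ_succ, mul_assoc]

theorem tsum_poissonWeight_mul_div {mu : ℝ} (hmu : 0 < mu) (f : ℕ → ℝ≥0∞) :
    ∑' k, poissonWeight mu k * (ENNReal.ofReal ((k : ℝ) / mu) * f k) =
      ∑' k, poissonWeight mu k * f (k + 1) := by
  rw [tsum_eq_zero_add' ENNReal.summable]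
  simp only [Nat.cast_zero, zero_div, ENNReal.ofReal_zero, zero_mul, mul_zero, zero_add]
  refine tsum_congr fun k => ?_
  rw [← mul_assoc, poissonWeight, poissonWeight, ← ENNReal.ofReal_mul (poissonPmf_nonneg hmu.le _)]
  congr 2
  have := succ_mul_poissonPmf_succ mu k
  push_cast
  field_simp
  linear_combination this

theorem tsum_poissonWeight_mul_sq_div {mu : ℝ} (hmu : 0 < mu) (f : ℕ → ℝ≥0∞) :
    ∑' k, poissonWeight mu k * (ENNReal.ofReal ((k : ℝ) ^ 2 / mu) * f k) =
      ∑' k, poissonWeight mu k * (((k : ℝ≥0∞) + 1) * f (k + 1)) := by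
  have h := tsum_poissonWeight_mul_div hmu fun k => (k : ℝ≥0∞) * f k
  push_cast at h
  rw [← h]
  refine tsum_congr fun k => ?_
  rw [sq, mul_div_right_comm, ENNReal.ofReal_mul (by positivity), ENNReal.ofReal_natCast, mul_assoc]

theorem tsum_prod_poissonWeight_mul_sum_sq_div {n : ℕ} (lam : Fin n → ℝ) (hlam : ∀ j, 0 < lam j)
    (f : ℕ → ℝ≥0∞) :
    ∑' u : Fin n → ℕ, (∏ j, poissonWeight (lam j) (u j)) *
        ((∑ j, ENNReal.ofReal ((u j : ℝ) ^ 2 / lam j)) * f (∑ j, u j)) =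
      ∑' s, poissonWeight (∑ j, lam j) s * (((s : ℝ≥0∞) + n) * f (s + 1)) := by
  induction n generalizing f with
  | zero =>
    symm
    rw [tsum_eq_single (β := ℕ) 0 fun s hs => by simp [poissonWeight, poissonPmf, hs]]
    simp [poissonWeight, poissonPmf]
  | succ n ih =>
    have hL : 0 ≤ ∑ j : Fin n, lam j.succ := Finset.sum_nonneg fun j _ => (hlam j.succ).le
    rw [tsum_pi_fin_succ, Fin.sum_univ_succ, ← tsum_poissonWeight_mul_add (hlam 0).le hL]
    have split : ∀ (a : ℕ) (u : Fin n → ℕ),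
        (∏ j, poissonWeight (lam j) ((Fin.cons a u : Fin (n + 1) → ℕ) j)) *
          ((∑ j, ENNReal.ofReal (((Fin.cons a u : Fin (n + 1) → ℕ) j : ℝ) ^ 2 / lam j)) *
            f (∑ j, (Fin.cons a u : Fin (n + 1) → ℕ) j)) =
        poissonWeight (lam 0) a * (ENNReal.ofReal ((a : ℝ) ^ 2 / lam 0) *
          ((∏ j, poissonWeight (lam j.succ) (u j)) * f (a + ∑ j, u j))) +
        poissonWeight (lam 0) a * ((∏ j, poissonWeight (lam j.succ) (u j)) *
          ((∑ j, ENNReal.ofReal ((u j : ℝ) ^ 2 / lam j.succ)) * f (a + ∑ j, u j))) := by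
      intro a u
      simp only [Fin.prod_univ_succ, Fin.sum_univ_succ, Fin.cons_zero, Fin.cons_succ]
      ring
    simp_rw [split, ENNReal.tsum_add, ENNReal.tsum_mul_left]
    have tail_sq := fun a => ih (fun j => lam j.succ) (fun j => hlam j.succ) fun k => f (a + k)
    have tail := fun a => tsum_prod_poissonWeight_mul (fun j => lam j.succ)
      (fun j => (hlam j.succ).le) fun k => f (a + k)
    simp_rw [tail_sq, tail]
    rw [tsum_poissonWeight_mul_sq_div (hlam 0), ← ENNReal.tsum_add]
    refine tsum_congr fun a => ?_
    rw [← mul_add, ← ENNReal.tsum_mul_left, ← ENNReal.tsum_add]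
    congr 1
    refine tsum_congr fun s => ?_
    rw [show a + 1 + s = a + s + 1 by ring, show a + (s + 1) = a + s + 1 by ring]
    push_cast
    ring

theorem tsum_poissonWeight {mu : ℝ} (hmu : 0 ≤ mu) : ∑' k, poissonWeight mu k = 1 := by
  unfold poissonWeight
  rw [← ENNReal.ofReal_tsum_of_nonneg (poissonPmf_nonneg hmu) (hasSum_poissonPmf mu).summable,
    (hasSum_poissonPmf mu).tsum_eq, ENNReal.ofReal_one]

theorem tsum_poissonWeight_mul_quadratic {mu : ℝ} (hmu : 0 ≤ mu) (A B C : ℝ)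
    (h : ∀ k : ℕ, 0 ≤ A + B * k + C * (k : ℝ) ^ 2) :
    ∑' k : ℕ, poissonWeight mu k * ENNReal.ofReal (A + B * k + C * (k : ℝ) ^ 2) =
      ENNReal.ofReal (A + B * mu + C * (mu ^ 2 + mu)) := by
  rw [← (hasSum_quadratic_mul_poissonPmf mu A B C).tsum_eq, ENNReal.ofReal_tsum_of_nonneg
    (fun k => mul_nonneg (h k) (poissonPmf_nonneg hmu k))
    (hasSum_quadratic_mul_poissonPmf mu A B C).summable]
  exact tsum_congr fun k => by rw [ENNReal.ofReal_mul (h k), poissonWeight, mul_comm]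

theorem tsum_poissonWeight_mul_ne_top {mu : ℝ} (hmu : 0 ≤ mu) (A B C : ℝ)
    (h : ∀ k : ℕ, 0 ≤ A + B * k + C * (k : ℝ) ^ 2) (f : ℕ → ℝ)
    (hf : ∀ k : ℕ, f k ≤ A + B * k + C * (k : ℝ) ^ 2) :
    ∑' k, poissonWeight mu k * ENNReal.ofReal (f k) ≠ ∞ := by
  refine ne_top_of_le_ne_top ?_ (ENNReal.tsum_le_tsum fun k =>
    mul_le_mul_right (ENNReal.ofReal_le_ofReal (hf k)) (poissonWeight mu k))
  rw [tsum_poissonWeight_mul_quadratic hmu A B C h]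
  exact ENNReal.ofReal_ne_top

/-- The mean of `(1 + d V) / 2` for `V` Poisson with mean `mu`. -/
noncomputable def shrinkMean (mu d : ℝ) : ℝ := (1 + d * mu) / 2

/-- The second moment of `(1 + d V) / 2` for `V` Poisson with mean `mu`. -/
noncomputable def shrinkSq (mu d : ℝ) : ℝ := (1 + 2 * d * mu + d ^ 2 * (mu ^ 2 + mu)) / 4

theorem sq_shrinkMean_le {mu : ℝ} (hmu : 0 ≤ mu) (d : ℝ) : shrinkMean mu d ^ 2 ≤ shrinkSq mu d := by
  unfold shrinkMean shrinkSq
  nlinarith [mul_nonneg (sq_nonneg d) hmu]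

theorem tsum_poissonWeight_mul_loss {n : ℕ} {mu : ℝ} (hmu : 0 ≤ mu) (lam : Fin n → ℝ)
    (hlam : ∀ j, 0 < lam j) (d : ℝ) (u : Fin n → ℝ) :
    ∑' v : ℕ, poissonWeight mu v *
        ENNReal.ofReal (∑ j, ((1 + d * v) / 2 * u j - lam j) ^ 2 / lam j) =
      ENNReal.ofReal (∑ j, (shrinkSq mu d * (u j ^ 2 / lam j) - 2 * shrinkMean mu d * u j +
        lam j)) := by
  have expand : ∀ v : ℝ, ∑ j, ((1 + d * v) / 2 * u j - lam j) ^ 2 / lam j =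
      ∑ j, (u j ^ 2 / lam j / 4 - u j + lam j) +
        (∑ j, (d * (u j ^ 2 / lam j) / 2 - d * u j)) * v +
        (∑ j, d ^ 2 * (u j ^ 2 / lam j) / 4) * v ^ 2 := by
    intro v
    rw [Finset.sum_mul, Finset.sum_mul, ← Finset.sum_add_distrib, ← Finset.sum_add_distrib]
    refine Finset.sum_congr rfl fun j _ => ?_
    have := (hlam j).ne'
    field_simp
    ring
  simp_rw [expand]
  rw [tsum_poissonWeight_mul_quadratic hmu]
  · congr 1
    rw [Finset.sum_mul, Finset.sum_mul, ← Finset.sum_add_distrib, ← Finset.sum_add_distrib]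
    refine Finset.sum_congr rfl fun j _ => ?_
    unfold shrinkSq shrinkMean
    ring
  · intro v
    rw [← expand]
    exact Finset.sum_nonneg fun j _ => div_nonneg (sq_nonneg _) (hlam j).le

theorem nonneg_of_sq_le {p q x mu : ℝ} (hmu : 0 < mu) (h : p ^ 2 ≤ q) :
    0 ≤ q * (x ^ 2 / mu) - 2 * p * x + mu := by
  have h1 : p ^ 2 * (x ^ 2 / mu) ≤ q * (x ^ 2 / mu) :=
    mul_le_mul_of_nonneg_right h (by positivity)
  have h2 : p ^ 2 * (x ^ 2 / mu) - 2 * p * x + mu = (p * x - mu) ^ 2 / mu := by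
    field_simp
    ring
  have h3 : 0 ≤ (p * x - mu) ^ 2 / mu := by positivity
  linarith

theorem tsum_prod_poissonWeight_mul_loss {a : ℕ} (lam : Fin (a + 1) → ℝ) (hlam : ∀ j, 0 < lam j)
    (p q : ℕ → ℝ) (K : ℝ) (hp : ∀ s, 0 ≤ p s) (hpK : ∀ s, p s ≤ K) (hpq : ∀ s, p s ^ 2 ≤ q s) :
    ∑' u : Fin (a + 1) → ℕ, (∏ j, poissonWeight (lam j) (u j)) *
        ENNReal.ofReal (∑ j, (q (∑ k, u k) * ((u j : ℝ) ^ 2 / lam j) -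
          2 * p (∑ k, u k) * u j + lam j)) =
      ∑' s, poissonWeight (∑ j, lam j) s *
        ENNReal.ofReal (q s * (s * (s + a) / ∑ j, lam j) - 2 * p s * s + ∑ j, lam j) := by
  set L := ∑ j, lam j with hL
  have hL0 : 0 < L := Finset.sum_pos (fun j _ => hlam j) Finset.univ_nonempty
  have hq : ∀ s, 0 ≤ q s := fun s => (sq_nonneg _).trans (hpq s)
  have left : ∀ u : Fin (a + 1) → ℕ,
      ENNReal.ofReal (∑ j, (q (∑ k, u k) * ((u j : ℝ) ^ 2 / lam j) -
          2 * p (∑ k, u k) * u j + lam j)) +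
        ENNReal.ofReal (2 * p (∑ k, u k) * (∑ k, u k : ℕ)) =
      (∑ j, ENNReal.ofReal ((u j : ℝ) ^ 2 / lam j)) * ENNReal.ofReal (q (∑ k, u k)) +
        ENNReal.ofReal L := by
    intro u
    have hnn : ∀ j ∈ Finset.univ, 0 ≤ (u j : ℝ) ^ 2 / lam j := fun j _ =>
      div_nonneg (sq_nonneg _) (hlam j).le
    have := hp (∑ k, u k)
    rw [← ENNReal.ofReal_sum_of_nonneg hnn, ← ENNReal.ofReal_mul (Finset.sum_nonneg hnn),
      ← ENNReal.ofReal_add (Finset.sum_nonneg fun j _ => nonneg_of_sq_le (hlam j) (hpq _))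
        (by positivity),
      ← ENNReal.ofReal_add (mul_nonneg (Finset.sum_nonneg hnn) (hq _)) hL0.le]
    congr 1
    rw [Finset.sum_add_distrib, Finset.sum_sub_distrib, ← Finset.mul_sum, ← Finset.mul_sum]
    push_cast
    ring
  have right : ∀ s : ℕ,
      ENNReal.ofReal (q s * (s * (s + a) / L) - 2 * p s * s + L) +
        ENNReal.ofReal (2 * p s * s) =
      ENNReal.ofReal ((s : ℝ) / L) * (((s : ℝ≥0∞) + a) * ENNReal.ofReal (q s)) +
        ENNReal.ofReal L := by
    intro s
    have h1 := hp s
    have h2 := hq s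
    have h3 := nonneg_of_sq_le (x := (s : ℝ)) hL0 (hpq s)
    have h4 : 0 ≤ q s * (s * a / L) := by positivity
    have h5 : q s * (s * (s + a) / L) = q s * ((s : ℝ) ^ 2 / L) + q s * (s * a / L) := by ring
    rw [show (s : ℝ≥0∞) + a = ENNReal.ofReal ((s : ℝ) + a) by
        rw [ENNReal.ofReal_add (by positivity) (by positivity)]; simp,
      ← ENNReal.ofReal_mul (by positivity), ← ENNReal.ofReal_mul (by positivity),
      ← ENNReal.ofReal_add (by linarith) (by positivity),
      ← ENNReal.ofReal_add (by positivity) hL0.le]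
    congr 1
    ring
  have fin : ∑' s, poissonWeight L s * ENNReal.ofReal (2 * p s * s) ≠ ∞ := by
    have hK : 0 ≤ K := (hp 0).trans (hpK 0)
    refine tsum_poissonWeight_mul_ne_top hL0.le 0 (2 * K) 0 (fun k => by positivity) _ fun k => ?_
    have := mul_le_mul_of_nonneg_right (hpK k) (Nat.cast_nonneg (α := ℝ) k)
    linarith
  refine (ENNReal.add_left_inj fin).1 ?_
  rw [← ENNReal.tsum_add]
  simp_rw [← mul_add, right, mul_add]
  rw [ENNReal.tsum_add,
    tsum_poissonWeight_mul_div hL0 (fun s => ((s : ℝ≥0∞) + a) * ENNReal.ofReal (q s)),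
    ← tsum_prod_poissonWeight_mul lam (fun j => (hlam j).le)
      (fun s => ENNReal.ofReal (2 * p s * s)), ← ENNReal.tsum_add]
  simp_rw [← mul_add, left, mul_add]
  rw [ENNReal.tsum_add,
    tsum_prod_poissonWeight_mul_sum_sq_div lam hlam fun s => ENNReal.ofReal (q s),
    tsum_prod_poissonWeight_mul lam (fun j => (hlam j).le) fun _ => ENNReal.ofReal L]
  congr 1
  refine tsum_congr fun s => ?_
  push_cast
  ring

/-- The conditional risk, given the total count `s` of a group of size `a + 1`, of the estimator
multiplying the counts by `(1 + d V) / 2`. -/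
noncomputable def conditionalRisk (mu : ℝ) (a : ℕ) (d : ℝ) (s : ℕ) : ℝ :=
  shrinkSq mu d * (s * (s + a) / mu) - 2 * shrinkMean mu d * s + mu

theorem conditionalRisk_nonneg {mu : ℝ} (hmu : 0 < mu) (a : ℕ) (d : ℝ) (s : ℕ) :
    0 ≤ conditionalRisk mu a d s := by
  have h1 := sq_shrinkMean_le hmu.le d
  have h2 := nonneg_of_sq_le (x := (s : ℝ)) hmu h1
  have h3 : 0 ≤ shrinkSq mu d * (s * a / mu) :=
    mul_nonneg ((sq_nonneg _).trans h1) (by positivity)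
  unfold conditionalRisk
  have h4 : shrinkSq mu d * (s * (s + a) / mu) =
    shrinkSq mu d * ((s : ℝ) ^ 2 / mu) + shrinkSq mu d * (s * a / mu) := by ring
  linarith

theorem conditionalRisk_gap {mu : ℝ} (hmu : 0 < mu) (a s : ℕ) :
    conditionalRisk mu a ((s + 1 : ℕ) + (a : ℕ) : ℝ)⁻¹ (s + 1) + a / 2 ≤
      conditionalRisk mu a ((s + 1 : ℕ) : ℝ)⁻¹ (s + 1) + a / 2 * (mu / (s + 2)) := by
  obtain rfl | ha := Nat.eq_zero_or_pos a
  · simp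
  have ha' : (1 : ℝ) ≤ a := by exact_mod_cast ha
  set x : ℝ := ((s + 1 : ℕ) : ℝ) with hx
  have hx0 : 0 < x := by rw [hx]; positivity
  have hs : (s : ℝ) + 2 = x + 1 := by rw [hx]; push_cast; ring
  have gap : conditionalRisk mu a x⁻¹ (s + 1) - conditionalRisk mu a (x + a)⁻¹ (s + 1) =
      a * ((mu + 1) * ((x + a)⁻¹ + x⁻¹) / 4 + 1 / 2 - mu * (x + a)⁻¹) := by
    unfold conditionalRisk shrinkSq shrinkMean
    rw [← hx]
    have : x + a ≠ 0 := by positivity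
    field_simp
    ring
  have h1 : (x + a)⁻¹ ≤ x⁻¹ := inv_anti₀ hx0 (by linarith)
  have h2 : (x + a)⁻¹ ≤ (x + 1)⁻¹ := inv_anti₀ (by positivity) (by linarith)
  have h3 : 0 ≤ (x + a)⁻¹ := by positivity
  have h4 : 1 / 2 - mu * (x + 1)⁻¹ / 2 ≤
      (mu + 1) * ((x + a)⁻¹ + x⁻¹) / 4 + 1 / 2 - mu * (x + a)⁻¹ := by
    nlinarith [mul_le_mul_of_nonneg_left h1 (by linarith : 0 ≤ mu + 1),
      mul_le_mul_of_nonneg_left h2 hmu.le]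
  have h5 := mul_le_mul_of_nonneg_left h4 (Nat.cast_nonneg (α := ℝ) a)
  rw [hs, div_eq_mul_inv mu]
  linarith

theorem conditionalRisk_le {mu : ℝ} (hmu : 0 < mu) (a : ℕ) {d : ℝ} (hd : 0 ≤ d) (hd1 : d ≤ 1)
    (s : ℕ) : conditionalRisk mu a d s ≤ mu + (shrinkSq mu 1 * a / mu) * s +
      (shrinkSq mu 1 / mu) * (s : ℝ) ^ 2 := by
  have h1 : shrinkSq mu d ≤ shrinkSq mu 1 := by
    unfold shrinkSq; gcongr
  have h2 : 0 ≤ 2 * shrinkMean mu d * s := by unfold shrinkMean; positivity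
  have h3 : shrinkSq mu d * (s * (s + a) / mu) ≤ shrinkSq mu 1 * (s * (s + a) / mu) := by gcongr
  have h4 : shrinkSq mu 1 * (s * (s + a) / mu) =
    (shrinkSq mu 1 * a / mu) * s + (shrinkSq mu 1 / mu) * (s : ℝ) ^ 2 := by ring
  unfold conditionalRisk
  linarith

theorem tsum_conditionalRisk_ne_top {mu : ℝ} (hmu : 0 < mu) (a : ℕ) (d : ℕ → ℝ)
    (hd : ∀ s, 0 ≤ d s) (hd1 : ∀ s, d s ≤ 1) :
    ∑' s, poissonWeight mu s * ENNReal.ofReal (conditionalRisk mu a (d s) s) ≠ ∞ :=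
  tsum_poissonWeight_mul_ne_top hmu.le _ _ _
    (fun k => (conditionalRisk_nonneg hmu a (d k) k).trans
      (conditionalRisk_le hmu a (hd k) (hd1 k) k)) _
    fun k => conditionalRisk_le hmu a (hd k) (hd1 k) k

theorem tsum_conditionalRisk_add_le {mu : ℝ} (hmu : 0 < mu) (a : ℕ) :
    ∑' s : ℕ, poissonWeight mu s *
        ENNReal.ofReal (conditionalRisk mu a ((s : ℝ) + (a : ℕ))⁻¹ s) +
        ENNReal.ofReal (a / 2) * poissonWeight mu 1 ≤
      ∑' s : ℕ, poissonWeight mu s * ENNReal.ofReal (conditionalRisk mu a (s : ℝ)⁻¹ s) := by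
  set c := ENNReal.ofReal ((a : ℝ) / 2) with hc
  have fin : c * ∑' s, poissonWeight mu (s + 2) ≠ ∞ := by
    refine ENNReal.mul_ne_top ENNReal.ofReal_ne_top (ne_top_of_le_ne_top ENNReal.one_ne_top ?_)
    rw [← tsum_poissonWeight hmu.le]
    exact ENNReal.tsum_comp_le_tsum_of_injective (add_left_injective 2) _
  refine (ENNReal.add_le_add_iff_right fin).1 ?_
  rw [add_assoc, ← mul_add, ← tsum_eq_zero_add' (f := fun s => poissonWeight mu (s + 1))
    ENNReal.summable, tsum_eq_zero_add' ENNReal.summable,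
    tsum_eq_zero_add' (f := fun s : ℕ => poissonWeight mu s *
      ENNReal.ofReal (conditionalRisk mu a (s : ℝ)⁻¹ s)) ENNReal.summable,
    add_assoc, add_assoc, ← ENNReal.tsum_mul_left, ← ENNReal.tsum_mul_left, ← ENNReal.tsum_add,
    ← ENNReal.tsum_add]
  refine add_le_add (by simp [conditionalRisk]) (ENNReal.tsum_le_tsum fun s => ?_)
  have next : poissonPmf mu (s + 2) = mu / (s + 2) * poissonPmf mu (s + 1) := by
    have := succ_mul_poissonPmf_succ mu (s + 1)
    push_cast at this
    have h : (s : ℝ) + 2 ≠ 0 := by positivity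
    rw [div_mul_eq_mul_div, eq_div_iff h]
    linear_combination this
  have hw := poissonPmf_nonneg hmu.le (s + 1)
  have hw2 := poissonPmf_nonneg hmu.le (s + 2)
  have h0 := conditionalRisk_nonneg hmu a ((s + 1 : ℕ) + (a : ℕ) : ℝ)⁻¹ (s + 1)
  have h1 := conditionalRisk_nonneg hmu a ((s + 1 : ℕ) : ℝ)⁻¹ (s + 1)
  unfold poissonWeight
  rw [hc, ← ENNReal.ofReal_mul hw, ← ENNReal.ofReal_mul hw, ← ENNReal.ofReal_mul (by positivity),
    ← ENNReal.ofReal_mul (by positivity), ← ENNReal.ofReal_add (by positivity) (by positivity),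
    ← ENNReal.ofReal_add (by positivity) (by positivity)]
  refine ENNReal.ofReal_le_ofReal ?_
  rw [next]
  have := mul_le_mul_of_nonneg_left (conditionalRisk_gap hmu a s) hw
  linarith

/-- The contribution of a single group to the risk of an estimator acting groupwise. -/
noncomputable def groupRisk {n : ℕ} (lam : Fin n → ℝ) (D : (Fin n → ℕ) → ℕ → Fin n → ℝ) : ℝ≥0∞ :=
  ∑' u : Fin n → ℕ, ∑' v : ℕ, ENNReal.ofReal (∑ j, (D u v j - lam j) ^ 2 / lam j) *
    (poissonWeight (∑ j, lam j) v * ∏ j, poissonWeight (lam j) (u j))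

theorem groupRisk_eq_tsum_conditionalRisk {a : ℕ} (lam : Fin (a + 1) → ℝ) (hlam : ∀ j, 0 < lam j)
    (d : ℕ → ℝ) (hd : ∀ s, 0 ≤ d s) (hd1 : ∀ s, d s ≤ 1) :
    groupRisk lam (fun u v j => (1 + d (∑ k, u k) * v) / 2 * u j) =
      ∑' s, poissonWeight (∑ j, lam j) s *
        ENNReal.ofReal (conditionalRisk (∑ j, lam j) a (d s) s) := by
  have hL0 : 0 < ∑ j, lam j := Finset.sum_pos (fun j _ => hlam j) Finset.univ_nonempty
  unfold conditionalRisk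
  rw [← tsum_prod_poissonWeight_mul_loss lam hlam (fun s => shrinkMean (∑ j, lam j) (d s))
    (fun s => shrinkSq (∑ j, lam j) (d s)) (shrinkMean (∑ j, lam j) 1)]
  · refine tsum_congr fun u => ?_
    rw [← tsum_poissonWeight_mul_loss hL0.le lam hlam _ fun j => (u j : ℝ), ← ENNReal.tsum_mul_left]
    exact tsum_congr fun v => by ring
  · intro s
    have := hd s
    unfold shrinkMean
    positivity
  · intro s
    have := hd1 s
    unfold shrinkMean
    gcongr
  · exact fun s => sq_shrinkMean_le hL0.le _

theorem risk2_eq_sum_groupRisk (m : ℕ) (n : Fin m → ℕ) (lam : (i : Fin m) → Fin (n i) → ℝ)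
    (hlam : ∀ i j, 0 < lam i j) (D : (i : Fin m) → (Fin (n i) → ℕ) → ℕ → Fin (n i) → ℝ) :
    risk2 m n (fun x y i => D i (x i) (y i)) lam = ∑ i, groupRisk (lam i) (D i) := by
  have hsum : ∀ i, 0 ≤ ∑ j, lam i j := fun i => Finset.sum_nonneg fun j _ => (hlam i j).le
  have weight_nonneg : ∀ i (u : Fin (n i) → ℕ) (v : ℕ),
      0 ≤ poissonPmf (∑ j, lam i j) v * ∏ j, poissonPmf (lam i j) (u j) := fun i u v =>
    mul_nonneg (poissonPmf_nonneg (hsum i) _)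
      (Finset.prod_nonneg fun j _ => poissonPmf_nonneg (hlam i j).le _)
  have hpmf : ∀ x y, ENNReal.ofReal (jointPmf2 m n lam x y) =
      ∏ i, (poissonWeight (∑ j, lam i j) (y i) * ∏ j, poissonWeight (lam i j) (x i j)) := by
    intro x y
    unfold jointPmf2 poissonWeight
    rw [ENNReal.ofReal_prod_of_nonneg fun i _ => weight_nonneg i _ _]
    refine Finset.prod_congr rfl fun i _ => ?_
    rw [ENNReal.ofReal_mul (poissonPmf_nonneg (hsum i) _),
      ENNReal.ofReal_prod_of_nonneg fun j _ => poissonPmf_nonneg (hlam i j).le _]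
  have mass : ∀ i, ∑' u : Fin (n i) → ℕ, ∑' v : ℕ,
      poissonWeight (∑ j, lam i j) v * ∏ j, poissonWeight (lam i j) (u j) = 1 := by
    intro i
    simp_rw [ENNReal.tsum_mul_right, tsum_poissonWeight (hsum i), one_mul]
    rw [tsum_pi_prod_eq_prod_tsum fun j => poissonWeight (lam i j)]
    exact Finset.prod_eq_one fun j _ => tsum_poissonWeight (hlam i j).le
  have split : ∀ x y, ENNReal.ofReal ((∑ i, ∑ j, (D i (x i) (y i) j - lam i j) ^ 2 / lam i j) *
      jointPmf2 m n lam x y) = ∑ i, ∏ k,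
        ((if k = i then ENNReal.ofReal (∑ j, (D k (x k) (y k) j - lam k j) ^ 2 / lam k j) else 1) *
        (poissonWeight (∑ j, lam k j) (y k) * ∏ j, poissonWeight (lam k j) (x k j))) := by
    intro x y
    have hnn : ∀ i ∈ Finset.univ, 0 ≤ ∑ j, (D i (x i) (y i) j - lam i j) ^ 2 / lam i j :=
      fun i _ => Finset.sum_nonneg fun j _ => div_nonneg (sq_nonneg _) (hlam i j).le
    rw [ENNReal.ofReal_mul (Finset.sum_nonneg hnn), hpmf, ENNReal.ofReal_sum_of_nonneg hnn,
      Finset.sum_mul]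
    refine Finset.sum_congr rfl fun i _ => ?_
    symm
    rw [Finset.prod_mul_distrib, Finset.prod_ite_eq' Finset.univ i, if_pos (Finset.mem_univ i)]
  unfold risk2
  simp_rw [split]
  have swap : ∀ f : ((i : Fin m) → Fin (n i) → ℕ) → (Fin m → ℕ) → Fin m → ℝ≥0∞,
      ∑' x, ∑' y, ∑ i, f x y i = ∑ i, ∑' x, ∑' y, f x y i := fun f => by
    rw [← Summable.tsum_finsetSum fun i _ => ENNReal.summable]
    exact tsum_congr fun x => Summable.tsum_finsetSum fun i _ => ENNReal.summable
  rw [swap]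
  refine Finset.sum_congr rfl fun i _ => ?_
  have inner : ∀ x : (i : Fin m) → Fin (n i) → ℕ, _ := fun x => tsum_pi_prod_eq_prod_tsum
    (α := fun _ : Fin m => ℕ) fun k v =>
      (if k = i then ENNReal.ofReal (∑ j, (D k (x k) v j - lam k j) ^ 2 / lam k j) else 1) *
        (poissonWeight (∑ j, lam k j) v * ∏ j, poissonWeight (lam k j) (x k j))
  simp_rw [inner]
  rw [tsum_pi_prod_eq_prod_tsum fun k (u : Fin (n k) → ℕ) => ∑' v : ℕ,
      (if k = i then ENNReal.ofReal (∑ j, (D k u v j - lam k j) ^ 2 / lam k j) else 1) *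
        (poissonWeight (∑ j, lam k j) v * ∏ j, poissonWeight (lam k j) (u j)),
    Finset.prod_eq_single i]
  · simp [groupRisk]
  · intro k _ hk
    simpa [hk] using mass k
  · simp

theorem groupRisk_shrink_comparison {n : ℕ} (hn : 1 ≤ n) (lam : Fin n → ℝ) (hlam : ∀ j, 0 < lam j) :
    groupRisk lam (fun u v j => (1 + ((∑ k, u k : ℕ) + ((n - 1 : ℕ) : ℝ))⁻¹ * v) / 2 * u j) ≠ ∞ ∧
    groupRisk lam (fun u v j => (1 + ((∑ k, u k : ℕ) + ((n - 1 : ℕ) : ℝ))⁻¹ * v) / 2 * u j) ≤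
      groupRisk lam (fun u v j => (1 + ((∑ k, u k : ℕ) : ℝ)⁻¹ * v) / 2 * u j) ∧
    (2 ≤ n →
      groupRisk lam (fun u v j => (1 + ((∑ k, u k : ℕ) + ((n - 1 : ℕ) : ℝ))⁻¹ * v) / 2 * u j) <
        groupRisk lam (fun u v j => (1 + ((∑ k, u k : ℕ) : ℝ)⁻¹ * v) / 2 * u j)) := by
  obtain ⟨a, rfl⟩ : ∃ a, n = a + 1 := ⟨n - 1, by omega⟩
  have hL0 : 0 < ∑ j, lam j := Finset.sum_pos (fun j _ => hlam j) Finset.univ_nonempty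
  have hinv : ∀ b s : ℕ, ((s : ℝ) + b)⁻¹ ≤ 1 := fun b s => by
    exact_mod_cast Nat.cast_inv_le_one (s + b)
  rw [Nat.add_sub_cancel,
    groupRisk_eq_tsum_conditionalRisk lam hlam (fun s => ((s : ℝ) + a)⁻¹) (fun s => by positivity)
      (hinv a),
    groupRisk_eq_tsum_conditionalRisk lam hlam (fun s => (s : ℝ)⁻¹) (fun s => by positivity)
      (fun s => by simpa using hinv 0 s)]
  have key := tsum_conditionalRisk_add_le hL0 a
  have fin := tsum_conditionalRisk_ne_top hL0 a (fun s => ((s : ℝ) + a)⁻¹)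
    (fun s => by positivity) (hinv a)
  refine ⟨fin, le_self_add.trans key, fun h2 => lt_of_lt_of_le (ENNReal.lt_add_right fin ?_) key⟩
  have ha : (0 : ℝ) < a := by exact_mod_cast (by omega : 0 < a)
  exact mul_ne_zero (ENNReal.ofReal_pos.2 (by positivity)).ne'
    (ENNReal.ofReal_pos.2 (poissonPmf_pos hL0 1)).ne'

theorem estML2_eq_shrink (m : ℕ) (n : Fin m → ℕ) :
    estML2 m n = fun x y i j =>
      (1 + ((∑ k, x i k : ℕ) : ℝ)⁻¹ * (y i : ℝ)) / 2 * (x i j : ℝ) := by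
  funext x y i j
  unfold estML2
  rw [← Nat.cast_sum]
  obtain h | h := Nat.eq_zero_or_pos (∑ k, x i k)
  · have := (Finset.sum_eq_zero_iff.1 h) j (Finset.mem_univ j)
    simp [this]
  · have h' : ((∑ k, x i k : ℕ) : ℝ) ≠ 0 := by exact_mod_cast h.ne'
    field_simp

theorem estO2_eq_shrink (m : ℕ) (n : Fin m → ℕ) (hn : ∀ i, 1 ≤ n i) :
    estO2 m n = fun x y i j =>
      (1 + ((∑ k, x i k : ℕ) + ((n i - 1 : ℕ) : ℝ))⁻¹ * (y i : ℝ)) / 2 * (x i j : ℝ) := by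
  funext x y i j
  unfold estO2
  rw [← Nat.cast_sum, Nat.cast_sub (hn i), Nat.cast_one, ← add_sub_assoc]
  obtain h | h := Nat.eq_zero_or_pos (∑ k, x i k)
  · have := (Finset.sum_eq_zero_iff.1 h) j (Finset.mem_univ j)
    simp [this]
  · have h1 : (0 : ℝ) < (∑ k, x i k : ℕ) := by exact_mod_cast h
    have h2 : (1 : ℝ) ≤ n i := by exact_mod_cast hn i
    have h' : ((∑ k, x i k : ℕ) : ℝ) + n i - 1 ≠ 0 := by linarith
    field_simp
    ring

/- STATEMENT 12: if max_i n_i ≥ 2, then λ^O strictly dominates λ^ML at every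
parameter point in the multi-group model. -/
theorem stmt_12 (m : ℕ) (hm : 1 ≤ m) (n : Fin m → ℕ) (hn : ∀ i, 1 ≤ n i)
    (hmax : ∃ i, 2 ≤ n i)
    (lam : (i : Fin m) → Fin (n i) → ℝ) (hlam : ∀ i j, 0 < lam i j) :
    risk2 m n (estO2 m n) lam < risk2 m n (estML2 m n) lam := by
  rw [estO2_eq_shrink m n hn, estML2_eq_shrink,
    risk2_eq_sum_groupRisk m n lam hlam fun i u v j =>
      (1 + ((∑ k, u k : ℕ) + ((n i - 1 : ℕ) : ℝ))⁻¹ * v) / 2 * u j,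
    risk2_eq_sum_groupRisk m n lam hlam fun i u v j =>
      (1 + ((∑ k, u k : ℕ) : ℝ)⁻¹ * v) / 2 * u j]
  have group := fun i => groupRisk_shrink_comparison (hn i) (lam i) (hlam i)
  obtain ⟨i, hi⟩ := hmax
  rw [← Finset.add_sum_erase _ _ (Finset.mem_univ i),
    ← Finset.add_sum_erase _ _ (Finset.mem_univ i)]
  exact ENNReal.add_lt_add_of_lt_of_le (ENNReal.sum_ne_top.2 fun k _ => (group k).1)
    ((group i).2.2 hi) (Finset.sum_le_sum fun k _ => (group k).2.1)
end

section
/- Suppose m ≥ 2, min_{1≤i≤m} n_i ≥ 4, and for every i = 1,…,m, (m−1)²/(2m) + (m−1)/m² + (2n_i−3)/m ≤ (n_i−1)(n_i−3)/2. Then for every parameter λ (all λ_{i,j} > 0), R(λ̂, λ) < R(λ^O, λ); that is, λ̂ strictly dominates λ^O under the standardized squared error loss. -/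
open scoped BigOperators ENNReal

/-- The estimator λ̂_{i,j} =
((X··+Y·)/2)·((X_{i·}+Y_i)/(X··+Y·+m−1))·(X_{i,j}/(X_{i·}+n_i−1)). -/
noncomputable def estHat2 (m : ℕ) (n : Fin m → ℕ)
    (x : (i : Fin m) → Fin (n i) → ℕ) (y : Fin m → ℕ) (i : Fin m) (j : Fin (n i)) : ℝ :=
  ((∑ k, ∑ l, (x k l : ℝ)) + (∑ k, (y k : ℝ))) / 2 *
    (((∑ k, (x i k : ℝ)) + (y i : ℝ)) /
      ((∑ k, ∑ l, (x k l : ℝ)) + (∑ k, (y k : ℝ)) + (m : ℝ) - 1)) *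
    ((x i j : ℝ) / ((∑ k, (x i k : ℝ)) + (n i : ℝ) - 1))

section ProductPoisson

variable {ι : Type*} [Fintype ι]

/-- The joint pmf of independent Poisson(θ a) counts. -/
noncomputable def prodPmf (θ : ι → ℝ) (ω : ι → ℕ) : ℝ := ∏ a, poissonPmf (θ a) (ω a)

theorem prodPmf_pos {θ : ι → ℝ} (hθ : ∀ a, 0 < θ a) (ω : ι → ℕ) : 0 < prodPmf θ ω :=
  Finset.prod_pos fun a _ => poissonPmf_pos (hθ a) _

theorem prodPmf_add_single [DecidableEq ι] (θ : ι → ℝ) (a : ι) (ω : ι → ℕ) :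
    ((ω a : ℝ) + 1) * prodPmf θ (ω + Pi.single a 1) = θ a * prodPmf θ ω := by
  unfold prodPmf
  rw [← Finset.mul_prod_erase _ _ (Finset.mem_univ a),
    ← Finset.mul_prod_erase Finset.univ (fun b => poissonPmf (θ b) (ω b)) (Finset.mem_univ a),
    ← mul_assoc, ← mul_assoc]
  congr 1
  · simpa using succ_mul_poissonPmf_succ (θ a) (ω a)
  · refine Finset.prod_congr rfl fun b hb => ?_
    simp [Finset.ne_of_mem_erase hb]

theorem summable_prodPmf {θ : ι → ℝ} (hθ : ∀ a, 0 < θ a) : Summable (prodPmf θ) := by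
  classical
  refine summable_of_sum_le (c := 1) (fun ω => (prodPmf_pos hθ ω).le) fun u => ?_
  have hu : u ⊆ Fintype.piFinset fun a => u.image fun ω => ω a := fun ω hω =>
    Fintype.mem_piFinset.2 fun a => Finset.mem_image_of_mem _ hω
  refine (Finset.sum_le_sum_of_subset_of_nonneg hu fun ω _ _ => (prodPmf_pos hθ ω).le).trans ?_
  unfold prodPmf
  rw [← Finset.prod_univ_sum]
  exact Finset.prod_le_one (fun a _ => Finset.sum_nonneg fun k _ => (poissonPmf_pos (hθ a) k).le)
    fun a _ => sum_le_hasSum _ (fun k _ => (poissonPmf_pos (hθ a) k).le) (hasSum_poissonPmf _)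

/-- The Poisson shift identity `E[ω a * f ω] = θ a * E[f (ω + e_a)]`. -/
theorem hasSum_mul_prodPmf_iff [DecidableEq ι] (θ : ι → ℝ) (a : ι) (f : (ι → ℕ) → ℝ) (t : ℝ) :
    HasSum (fun ω => (ω a : ℝ) * f ω * prodPmf θ ω) t ↔
      HasSum (fun ω => θ a * f (ω + Pi.single a 1) * prodPmf θ ω) t := by
  have hinj : Function.Injective fun ω : ι → ℕ => ω + Pi.single a 1 := add_left_injective _
  rw [← hinj.hasSum_iff]
  · refine iff_of_eq (congrArg (HasSum · t) (funext fun ω => ?_))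
    have h := prodPmf_add_single θ a ω
    simp only [Function.comp_apply, Pi.add_apply, Pi.single_eq_same, Nat.cast_add, Nat.cast_one]
    linear_combination f (ω + Pi.single a 1) * h
  · intro ω hω
    have h0 : ω a = 0 := by
      by_contra h0
      refine hω ⟨ω - Pi.single a 1, funext fun b => ?_⟩
      by_cases hb : b = a
      · subst hb
        simp
        omega
      · simp [hb]
    simp [h0]

/-- The total count. -/
noncomputable def total (ω : ι → ℕ) : ℝ := ∑ a, (ω a : ℝ)

theorem total_nonneg (ω : ι → ℕ) : 0 ≤ total ω := Finset.sum_nonneg fun _ _ => Nat.cast_nonneg _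

theorem total_add_single [DecidableEq ι] (ω : ι → ℕ) (a : ι) :
    total (ω + Pi.single a 1) = total ω + 1 := by
  have h : ∑ b, ((Pi.single a 1 : ι → ℕ) b : ℝ) = 1 := by
    rw [← Nat.cast_sum, Finset.sum_pi_single']
    simp
  simp only [total, Pi.add_apply, Nat.cast_add, Finset.sum_add_distrib, h]

theorem summable_total_pow {θ : ι → ℝ} (hθ : ∀ a, 0 < θ a) (k : ℕ) (b : ℝ) :
    Summable fun ω => (total ω + b) ^ k * prodPmf θ ω := by
  classical
  induction k generalizing b with
  | zero => simpa using summable_prodPmf hθ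
  | succ k ih =>
    have h : ∀ a, Summable fun ω => (ω a : ℝ) * (total ω + b) ^ k * prodPmf θ ω := fun a => by
      obtain ⟨t, ht⟩ := (ih (b + 1)).mul_left (θ a)
      refine ⟨t, (hasSum_mul_prodPmf_iff θ a _ t).2
        ((congrArg (HasSum · t) (funext fun ω => ?_)).mp ht)⟩
      rw [total_add_single]
      ring
    refine ((summable_sum fun a (_ : a ∈ Finset.univ) => h a).add ((ih b).mul_left b)).congr
      fun ω => ?_
    rw [← Finset.sum_mul, ← Finset.sum_mul]
    change total ω * _ * _ + _ = _
    ring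

/-- Functions of the counts that are bounded by a polynomial in the total count. -/
def PolyBdd (f : (ι → ℕ) → ℝ) : Prop :=
  ∃ C : ℝ, ∃ k : ℕ, 0 ≤ C ∧ ∀ ω, |f ω| ≤ C * (total ω + 1) ^ k

namespace PolyBdd

variable {f g : (ι → ℕ) → ℝ}

theorem const (r : ℝ) : PolyBdd fun _ : ι → ℕ => r := ⟨|r|, 0, abs_nonneg r, fun ω => by simp⟩

theorem coord (a : ι) : PolyBdd fun ω : ι → ℕ => (ω a : ℝ) := by
  refine ⟨1, 1, zero_le_one, fun ω => ?_⟩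
  have h : (ω a : ℝ) ≤ total ω := Finset.single_le_sum (f := fun b => (ω b : ℝ))
    (fun _ _ => Nat.cast_nonneg _) (Finset.mem_univ a)
  rw [abs_of_nonneg (Nat.cast_nonneg _)]
  linarith

theorem add (hf : PolyBdd f) (hg : PolyBdd g) : PolyBdd fun ω => f ω + g ω := by
  obtain ⟨C, k, hC, hf⟩ := hf
  obtain ⟨D, l, hD, hg⟩ := hg
  refine ⟨C + D, k + l, add_nonneg hC hD, fun ω => ?_⟩
  have h1 : 1 ≤ total ω + 1 := by linarith [total_nonneg ω]
  have hk := pow_le_pow_right₀ h1 (Nat.le_add_right k l)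
  have hl := pow_le_pow_right₀ h1 (Nat.le_add_left l k)
  calc |f ω + g ω| ≤ |f ω| + |g ω| := abs_add_le _ _
    _ ≤ C * (total ω + 1) ^ (k + l) + D * (total ω + 1) ^ (k + l) := by
        gcongr
        · exact (hf ω).trans (by gcongr)
        · exact (hg ω).trans (by gcongr)
    _ = _ := by ring

theorem mul (hf : PolyBdd f) (hg : PolyBdd g) : PolyBdd fun ω => f ω * g ω := by
  obtain ⟨C, k, hC, hf⟩ := hf
  obtain ⟨D, l, hD, hg⟩ := hg
  refine ⟨C * D, k + l, mul_nonneg hC hD, fun ω => ?_⟩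
  have h1 := total_nonneg ω
  rw [abs_mul]
  calc |f ω| * |g ω| ≤ (C * (total ω + 1) ^ k) * (D * (total ω + 1) ^ l) :=
        mul_le_mul (hf ω) (hg ω) (abs_nonneg _) (by positivity)
    _ = _ := by ring

theorem sub (hf : PolyBdd f) (hg : PolyBdd g) : PolyBdd fun ω => f ω - g ω := by
  simpa [sub_eq_add_neg] using hf.add ((const (-1)).mul hg)

theorem pow (hf : PolyBdd f) (k : ℕ) : PolyBdd fun ω => f ω ^ k := by
  induction k with
  | zero => simpa using const 1
  | succ k ih => simpa [pow_succ] using ih.mul hf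

theorem div (hf : PolyBdd f) (hg : ∀ ω, 1 ≤ g ω) : PolyBdd fun ω => f ω / g ω := by
  obtain ⟨C, k, hC, hf⟩ := hf
  refine ⟨C, k, hC, fun ω => le_trans ?_ (hf ω)⟩
  rw [abs_div]
  exact div_le_self (abs_nonneg _) ((hg ω).trans (le_abs_self _))

theorem sum {κ : Type*} (s : Finset κ) {F : κ → (ι → ℕ) → ℝ} (hF : ∀ i ∈ s, PolyBdd (F i)) :
    PolyBdd fun ω => ∑ i ∈ s, F i ω := by
  classical
  induction s using Finset.induction_on with
  | empty => simpa using const 0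
  | insert i s hi ih =>
    simp only [Finset.sum_insert hi]
    exact (hF i (Finset.mem_insert_self i s)).add
      (ih fun j hj => hF j (Finset.mem_insert_of_mem hj))

theorem summable {θ : ι → ℝ} (hθ : ∀ a, 0 < θ a) (hf : PolyBdd f) :
    Summable fun ω => f ω * prodPmf θ ω := by
  obtain ⟨C, k, -, hf⟩ := hf
  refine Summable.of_norm_bounded ((summable_total_pow hθ k 1).mul_left C) fun ω => ?_
  rw [Real.norm_eq_abs, abs_mul, abs_of_pos (prodPmf_pos hθ ω), ← mul_assoc]
  exact mul_le_mul_of_nonneg_right (hf ω) (prodPmf_pos hθ ω).le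

end PolyBdd

/-- Functions of the counts whose expectation exists and vanishes. -/
def NullMean (θ : ι → ℝ) (f : (ι → ℕ) → ℝ) : Prop := HasSum (fun ω => f ω * prodPmf θ ω) 0

namespace NullMean

variable {θ : ι → ℝ} {f g : (ι → ℕ) → ℝ}

theorem add (hf : NullMean θ f) (hg : NullMean θ g) : NullMean θ fun ω => f ω + g ω := by
  simpa [NullMean, add_mul] using HasSum.add hf hg

theorem sub (hf : NullMean θ f) (hg : NullMean θ g) : NullMean θ fun ω => f ω - g ω := by
  simpa [NullMean, sub_mul] using HasSum.sub hf hg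

theorem sum {κ : Type*} (s : Finset κ) {F : κ → (ι → ℕ) → ℝ} (hF : ∀ i ∈ s, NullMean θ (F i)) :
    NullMean θ fun ω => ∑ i ∈ s, F i ω := by
  simpa [NullMean, Finset.sum_mul] using hasSum_sum hF

theorem shift [DecidableEq ι] (hθ : ∀ a, 0 < θ a) (a : ι) (hf : PolyBdd f) :
    NullMean θ fun ω => (ω a : ℝ) * f ω - θ a * f (ω + Pi.single a 1) := by
  have h := (((PolyBdd.coord a).mul hf).summable hθ).hasSum
  simpa [NullMean, sub_mul] using h.sub ((hasSum_mul_prodPmf_iff θ a f _).1 h)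

end NullMean

end ProductPoisson

theorem div_le_tangent {c X Y : ℝ} (hc : 0 < c) (hX : 0 ≤ X) (hY : 0 ≤ Y) :
    X / (X + c) - (X - Y) * (2 * c / (X + Y + 2 * c) ^ 2) ≤ (X + Y) / (X + Y + 2 * c) := by
  have h : (X + Y) / (X + Y + 2 * c) - (X / (X + c) - (X - Y) * (2 * c / (X + Y + 2 * c) ^ 2)) =
      c * (X - Y) ^ 2 / ((X + c) * (X + Y + 2 * c) ^ 2) := by
    field_simp
    ring
  have : 0 ≤ c * (X - Y) ^ 2 / ((X + c) * (X + Y + 2 * c) ^ 2) := by positivity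
  linarith

/-- Pointwise bound on one group's contribution to the risk difference. -/
theorem group_bound {m n z S : ℝ} (hm : 2 ≤ m) (hn : 4 ≤ n) (hz : z = 0 ∨ 1 ≤ z) (hzS : z ≤ S)
    {B F : ℝ} (hB : B = z * (m - 1) / (S + m - 1) + (n - 1))
    (hF : F = (((z + 1) / 2 * ((S + 1) / (S + m))) ^ 2 - ((z + n) / 2) ^ 2) / (z + n) + B) :
    0 ≤ F ∧ F * (1 + z / (z + 2 * (n - 1))) - B ≤
      ((m - 1) ^ 2 * (z + 1) / (S + m) ^ 2 - 9 / (z + 7)) / 2 := by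
  have hz0 : 0 ≤ z := by rcases hz with h | h <;> linarith
  have hS0 : 0 ≤ S := hz0.trans hzS
  obtain ⟨d, rfl⟩ : ∃ d, m = d + 1 := ⟨m - 1, by ring⟩
  obtain ⟨c, rfl⟩ : ∃ c, n = c + 1 := ⟨n - 1, by ring⟩
  have hd : 1 ≤ d := by linarith
  have hc : 3 ≤ c := by linarith
  simp only [add_sub_cancel_right] at *
  have e1 : S + (d + 1) - 1 = S + d := by ring
  rw [e1] at hB
  set r := (S + 1) / (S + (d + 1)) with hr
  set u := z * d / (S + d) with hu
  set v := (z + 1) / (S + (d + 1)) with hv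
  have hr1 : 1 - r = d / (S + (d + 1)) := by rw [hr]; field_simp; ring
  have hu0 : 0 ≤ u := by positivity
  have hr0 : 0 ≤ r := by positivity
  have hvd : (z + 1) * (1 - r) = v * d := by rw [hr1, hv]; ring
  have huv : u ≤ v * d := by
    rw [hu, hv, div_mul_eq_mul_div, div_le_div_iff₀ (by positivity) (by positivity)]
    nlinarith
  have hr2 : r ≤ 1 := by
    have : 0 ≤ d / (S + (d + 1)) := by positivity
    linarith
  have hvu : z = 0 ∨ v * d ≤ 2 * u := by
    refine hz.imp_right fun hz1 => ?_
    rw [hu, hv, div_mul_eq_mul_div, mul_div_assoc', div_le_div_iff₀ (by positivity) (by positivity)]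
    have : (z + 1) * (S + d) ≤ 2 * z * (S + (d + 1)) := by nlinarith
    nlinarith
  set K := ((z + 1) ^ 2 * r ^ 2 - (z + 1 + c) ^ 2) / 4 + (z + 1 + c) * B with hK
  have hFK : F = K / (z + 1 + c) := by
    have : z + (c + 1) = z + 1 + c := by ring
    rw [hF, hK, this]
    field_simp
    ring
  have hK0 : 0 ≤ K := by
    have e : K = (z + 1) * u + c * u + c * (2 * z + 2 + 3 * c) / 4
        - (1 + r) * (z + 1) * (v * d) / 4 := by
      rw [← hvd, hK, hB]
      ring
    rcases hvu with h0 | h1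
    · have : K = (r ^ 2 - (1 + c) ^ 2) / 4 + (1 + c) * c := by
        rw [hK, hB, hu, h0]
        ring
      rw [this]
      nlinarith [sq_nonneg r]
    · have h2 : (1 + r) * (z + 1) * (v * d) ≤ 2 * (z + 1) * (2 * u) := by
        gcongr
        linarith
      have : 0 ≤ c * u := by positivity
      have : 0 ≤ c * (2 * z + 2 + 3 * c) / 4 := by positivity
      rw [e]
      linarith
  have hnum : 2 * K - (z + 2 * c + 1) * B ≤ (d ^ 2 * v ^ 2 - c ^ 2) / 2 := by
    have e : 2 * K - (z + 2 * c + 1) * B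
        = (d ^ 2 * v ^ 2 - c ^ 2) / 2 + (z + 1) * (u - v * d) := by
      have h3 : d ^ 2 * v ^ 2 = ((z + 1) * (1 - r)) ^ 2 := by rw [hvd]; ring
      rw [h3, ← hvd, hK, hB]
      ring
    have : 0 ≤ (z + 1) * (v * d - u) := mul_nonneg (by linarith) (by linarith)
    linarith
  have hF0 : 0 ≤ F := by rw [hFK]; positivity
  refine ⟨hF0, ?_⟩
  have h1 : F * (1 + z / (z + 2 * c)) ≤ 2 * K / (z + 2 * c + 1) := by
    have e : F * (1 + z / (z + 2 * c)) = 2 * K * ((z + c) / ((z + 1 + c) * (z + 2 * c))) := by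
      rw [hFK]
      field_simp
      ring
    rw [e, div_eq_mul_one_div (2 * K)]
    refine mul_le_mul_of_nonneg_left ?_ (by positivity)
    rw [div_le_div_iff₀ (by positivity) (by positivity)]
    linarith
  have h2 : 2 * K / (z + 2 * c + 1) - B ≤ (d ^ 2 * v ^ 2 - c ^ 2) / 2 / (z + 2 * c + 1) := by
    rw [le_div_iff₀ (by positivity), sub_mul, div_mul_cancel₀ _ (by positivity)]
    linarith
  have h3 : d ^ 2 * v ^ 2 / (z + 2 * c + 1) ≤ d ^ 2 * (z + 1) / (S + (d + 1)) ^ 2 := by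
    have e : d ^ 2 * v ^ 2 / (z + 2 * c + 1)
        = d ^ 2 * (z + 1) / (S + (d + 1)) ^ 2 * ((z + 1) / (z + 2 * c + 1)) := by
      rw [hv]
      field_simp
    rw [e]
    refine mul_le_of_le_one_right (by positivity) ?_
    rw [div_le_one (by positivity)]
    linarith
  have h4 : 9 / (z + 7) ≤ c ^ 2 / (z + 2 * c + 1) := by
    rw [div_le_div_iff₀ (by positivity) (by positivity)]
    have k1 : 0 ≤ z * ((c - 3) * (c + 3)) := mul_nonneg hz0 (mul_nonneg (by linarith) (by linarith))
    have k2 : 0 ≤ (c - 3) * (7 * c + 3) := mul_nonneg (by linarith) (by linarith)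
    linarith
  have h5 : (d ^ 2 * v ^ 2 - c ^ 2) / 2 / (z + 2 * c + 1)
      = (d ^ 2 * v ^ 2 / (z + 2 * c + 1) - c ^ 2 / (z + 2 * c + 1)) / 2 := by ring
  linarith

/-- The group bounds add up to a negative number. -/
theorem sum_group_bound_neg {m : ℕ} (hm : 2 ≤ m) {z : Fin m → ℝ} (hz : ∀ i, 0 ≤ z i) {S : ℝ}
    (hS : S = ∑ i, z i) :
    ∑ i, (((m : ℝ) - 1) ^ 2 * (z i + 1) / (S + m) ^ 2 - 9 / (z i + 7)) / 2 < 0 := by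
  have hm' : (2 : ℝ) ≤ m := by exact_mod_cast hm
  have hS0 : 0 ≤ S := hS ▸ Finset.sum_nonneg fun i _ => hz i
  have h1 : ∑ i, ((m : ℝ) - 1) ^ 2 * (z i + 1) / (S + m) ^ 2 = ((m : ℝ) - 1) ^ 2 / (S + m) := by
    rw [← Finset.sum_div, ← Finset.mul_sum, Finset.sum_add_distrib, ← hS]
    simp
    field_simp
  have h2 : (9 : ℝ) * m ^ 2 / (S + 7 * m) ≤ ∑ i, 9 / (z i + 7) := by
    have h := Finset.sq_sum_div_le_sum_sq_div Finset.univ (fun _ : Fin m => (3 : ℝ))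
      (g := fun i => z i + 7) fun i _ => by linarith [hz i]
    simp only [Finset.sum_add_distrib, ← hS] at h
    norm_num at h
    rwa [mul_comm (7 : ℝ), show (9 : ℝ) * m ^ 2 = (m * 3) ^ 2 by ring]
  have h3 : ((m : ℝ) - 1) ^ 2 / (S + m) < 9 * m ^ 2 / (S + 7 * m) := by
    rw [div_lt_div_iff₀ (by positivity) (by positivity)]
    have : ((m : ℝ) - 1) ^ 2 < m ^ 2 := by nlinarith
    nlinarith
  rw [← Finset.sum_div, Finset.sum_sub_distrib, h1]
  linarith

section Groups

variable {m : ℕ} {n : Fin m → ℕ}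

/-- The index set of all the counts: the pairs `(i, j)` for `X` and the groups `i` for `Y`. -/
abbrev CountIdx (n : Fin m → ℕ) : Type := (Σ i, Fin (n i)) ⊕ Fin m

/-- The Poisson means of all the counts. -/
noncomputable def rates (lam : (i : Fin m) → Fin (n i) → ℝ) : CountIdx n → ℝ :=
  Sum.elim (fun s => lam s.1 s.2) fun i => ∑ j, lam i j

theorem rates_pos (hn : ∀ i, 4 ≤ n i) {lam : (i : Fin m) → Fin (n i) → ℝ}
    (hlam : ∀ i j, 0 < lam i j) (a : CountIdx n) : 0 < rates lam a := by
  rcases a with ⟨i, j⟩ | i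
  · exact hlam i j
  · exact Finset.sum_pos (fun j _ => hlam i j) ⟨⟨0, by linarith [hn i]⟩, Finset.mem_univ _⟩

/-- The counts as one family, and as the pair `(X, Y)`. -/
def countEquiv (n : Fin m → ℕ) :
    (CountIdx n → ℕ) ≃ ((i : Fin m) → Fin (n i) → ℕ) × (Fin m → ℕ) where
  toFun ω := (fun i j => ω (Sum.inl ⟨i, j⟩), fun i => ω (Sum.inr i))
  invFun q := Sum.elim (fun s => q.1 s.1 s.2) q.2
  left_inv ω := by
    funext a
    rcases a with ⟨i, j⟩ | i <;> rfl
  right_inv q := rfl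

theorem jointPmf2_countEquiv (lam : (i : Fin m) → Fin (n i) → ℝ) (ω : CountIdx n → ℕ) :
    jointPmf2 m n lam (countEquiv n ω).1 (countEquiv n ω).2 = prodPmf (rates lam) ω := by
  rw [jointPmf2, prodPmf, Fintype.prod_sum_type, Fintype.prod_sigma, Finset.prod_mul_distrib,
    mul_comm]
  rfl

/-- The group sum `X_{i·}`. -/
noncomputable def groupX (ω : CountIdx n → ℕ) (i : Fin m) : ℝ := ∑ j, (ω (Sum.inl ⟨i, j⟩) : ℝ)

/-- The count `Y_i`. -/
def groupY (ω : CountIdx n → ℕ) (i : Fin m) : ℝ := ω (Sum.inr i)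

theorem groupX_nonneg (ω : CountIdx n → ℕ) (i : Fin m) : 0 ≤ groupX ω i :=
  Finset.sum_nonneg fun _ _ => Nat.cast_nonneg _

theorem groupY_nonneg (ω : CountIdx n → ℕ) (i : Fin m) : 0 ≤ groupY ω i := Nat.cast_nonneg _

theorem total_eq (ω : CountIdx n → ℕ) :
    total ω = (∑ i, ∑ j, (ω (Sum.inl ⟨i, j⟩) : ℝ)) + ∑ i, (ω (Sum.inr i) : ℝ) := by
  rw [total, Fintype.sum_sum_type, Fintype.sum_sigma]

theorem total_eq_sum_group (ω : CountIdx n → ℕ) : total ω = ∑ i, (groupX ω i + groupY ω i) := by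
  rw [total_eq, Finset.sum_add_distrib]
  rfl

theorem group_le_total (ω : CountIdx n → ℕ) (i : Fin m) : groupX ω i + groupY ω i ≤ total ω := by
  rw [total_eq_sum_group]
  exact Finset.single_le_sum (f := fun i => groupX ω i + groupY ω i)
    (fun k _ => add_nonneg (groupX_nonneg ω k) (groupY_nonneg ω k)) (Finset.mem_univ i)

theorem groupX_add_single_inl (ω : CountIdx n → ℕ) (i : Fin m) (j : Fin (n i)) :
    groupX (ω + Pi.single (Sum.inl ⟨i, j⟩) 1) i = groupX ω i + 1 := by
  simp [groupX, Finset.sum_add_distrib, Pi.single_apply]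

theorem groupX_add_single_inr (ω : CountIdx n → ℕ) (i : Fin m) :
    groupX (ω + Pi.single (Sum.inr i) 1) i = groupX ω i := by
  simp [groupX]

theorem groupY_add_single_inl (ω : CountIdx n → ℕ) (i : Fin m) (j : Fin (n i)) :
    groupY (ω + Pi.single (Sum.inl ⟨i, j⟩) 1) i = groupY ω i := by
  simp [groupY]

theorem groupY_add_single_inr (ω : CountIdx n → ℕ) (i : Fin m) :
    groupY (ω + Pi.single (Sum.inr i) 1) i = groupY ω i + 1 := by
  simp [groupY]

theorem polyBdd_groupX (i : Fin m) : PolyBdd fun ω : CountIdx n → ℕ => groupX ω i :=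
  PolyBdd.sum _ fun _ _ => PolyBdd.coord _

theorem polyBdd_groupY (i : Fin m) : PolyBdd fun ω : CountIdx n → ℕ => groupY ω i :=
  PolyBdd.coord _

theorem polyBdd_total : PolyBdd fun ω : CountIdx n → ℕ => total ω :=
  PolyBdd.sum _ fun _ _ => PolyBdd.coord _

/-- Exchanging the roles of `X_{i·}` and `Y_i`, which have the same distribution. -/
theorem nullMean_swap {lam : (i : Fin m) → Fin (n i) → ℝ} (hpos : ∀ a, 0 < rates lam a)
    (i : Fin m) (h : ℝ → ℝ → ℝ → ℝ)
    (h₀ : PolyBdd fun ω : CountIdx n → ℕ => h (groupX ω i) (groupX ω i + groupY ω i) (total ω))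
    (h₁ : PolyBdd fun ω : CountIdx n → ℕ =>
      h (groupX ω i + 1) (groupX ω i + groupY ω i) (total ω)) :
    NullMean (rates lam) fun ω =>
      groupX ω i * h (groupX ω i) (groupX ω i + groupY ω i) (total ω) -
        groupY ω i * h (groupX ω i + 1) (groupX ω i + groupY ω i) (total ω) := by
  have hx := NullMean.sum Finset.univ fun j _ => NullMean.shift hpos (Sum.inl ⟨i, j⟩) h₀
  have hy := NullMean.shift hpos (Sum.inr i) h₁
  refine (congrArg (NullMean (rates lam)) (funext fun ω => ?_)).mp (hx.sub hy)
  simp only [groupX_add_single_inl, groupY_add_single_inl, groupX_add_single_inr,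
    groupY_add_single_inr, total_add_single, Finset.sum_sub_distrib, ← Finset.sum_mul]
  change groupX ω i * _ - (∑ j, lam i j) * _ - (groupY ω i * _ - (∑ j, lam i j) * _) = _
  rw [show groupX ω i + 1 + groupY ω i = groupX ω i + (groupY ω i + 1) by ring]
  ring

/-- The standardized loss of the group `i` for the estimates `A * X_{i,j} / (X_{i·} + n_i - 1)`. -/
noncomputable def groupLoss (lam : (i : Fin m) → Fin (n i) → ℝ) (A : ℝ → ℝ → ℝ) (i : Fin m)
    (ω : CountIdx n → ℕ) : ℝ :=
  ∑ j, (A (groupX ω i + groupY ω i) (total ω) *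
    ((ω (Sum.inl ⟨i, j⟩) : ℝ) / (groupX ω i + n i - 1)) - lam i j) ^ 2 / lam i j

theorem PolyBdd.groupLoss (hn : ∀ i, 4 ≤ n i) (lam : (i : Fin m) → Fin (n i) → ℝ)
    {A : ℝ → ℝ → ℝ} (i : Fin m)
    (hA : PolyBdd fun ω : CountIdx n → ℕ => A (groupX ω i + groupY ω i) (total ω)) :
    PolyBdd (groupLoss lam A i) := by
  refine PolyBdd.sum _ fun j _ => ?_
  simp only [div_eq_mul_inv _ (lam i j)]
  have hni : (4 : ℝ) ≤ n i := by exact_mod_cast hn i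
  exact ((((hA.mul ((PolyBdd.coord _).div fun ω => by linarith [groupX_nonneg ω i])).sub
    (PolyBdd.const _)).pow 2).mul (PolyBdd.const _))

theorem nullMean_groupLoss (hn : ∀ i, 4 ≤ n i) {lam : (i : Fin m) → Fin (n i) → ℝ}
    (hlam : ∀ i j, 0 < lam i j) (A : ℝ → ℝ → ℝ) (i : Fin m)
    (hA : PolyBdd fun ω : CountIdx n → ℕ => A (groupX ω i + groupY ω i) (total ω)) :
    NullMean (rates lam) fun ω => groupLoss lam A i ω -
      (A (groupX ω i + groupY ω i + 1) (total ω + 1) ^ 2 / (groupX ω i + n i)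
        - 2 * A (groupX ω i + groupY ω i) (total ω) * groupX ω i / (groupX ω i + n i - 1)
        + ∑ j, lam i j) := by
  have hni : (4 : ℝ) ≤ n i := by exact_mod_cast hn i
  have hf : ∀ j, PolyBdd fun ω : CountIdx n → ℕ => (ω (Sum.inl ⟨i, j⟩) : ℝ) *
      (A (groupX ω i + groupY ω i) (total ω) / (groupX ω i + n i - 1)) ^ 2 * (lam i j)⁻¹ :=
    fun j => ((PolyBdd.coord _).mul
      ((hA.div fun ω => by linarith [groupX_nonneg ω i]).pow 2)).mul (PolyBdd.const _)
  have hx := NullMean.sum Finset.univ fun j _ =>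
    NullMean.shift (rates_pos hn hlam) (Sum.inl ⟨i, j⟩) (hf j)
  refine (congrArg (NullMean (rates lam)) (funext fun ω => ?_)).mp hx
  have hX := groupX_nonneg ω i
  simp only [groupX_add_single_inl, groupY_add_single_inl, total_add_single, groupLoss,
    Pi.add_apply, Pi.single_eq_same, Nat.cast_add, Nat.cast_one]
  rw [show groupX ω i + 1 + groupY ω i = groupX ω i + groupY ω i + 1 by ring,
    show groupX ω i + 1 + n i - 1 = groupX ω i + n i by ring]
  set a := A (groupX ω i + groupY ω i) (total ω)
  set b := A (groupX ω i + groupY ω i + 1) (total ω + 1)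
  set c := groupX ω i + n i - 1 with hc
  have hc0 : 0 < c := by linarith
  have hterm : ∀ j, (ω (Sum.inl ⟨i, j⟩) : ℝ) * ((ω (Sum.inl ⟨i, j⟩) : ℝ) * (a / c) ^ 2 *
      (lam i j)⁻¹) - rates lam (Sum.inl ⟨i, j⟩) * (((ω (Sum.inl ⟨i, j⟩) : ℝ) + 1) *
        (b / (groupX ω i + n i)) ^ 2 * (lam i j)⁻¹) =
      (a * ((ω (Sum.inl ⟨i, j⟩) : ℝ) / c) - lam i j) ^ 2 / lam i j
        + (2 * a / c * ω (Sum.inl ⟨i, j⟩) - lam i j)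
        - ((ω (Sum.inl ⟨i, j⟩) : ℝ) + 1) * (b / (groupX ω i + n i)) ^ 2 := fun j => by
    have := (hlam i j).ne'
    change _ - lam i j * _ = _
    field_simp
    ring
  rw [Finset.sum_congr rfl fun j _ => hterm j, Finset.sum_sub_distrib, Finset.sum_add_distrib,
    Finset.sum_sub_distrib, ← Finset.mul_sum, ← Finset.sum_mul, Finset.sum_add_distrib]
  change _ + (2 * a / c * groupX ω i - _) - (groupX ω i + _) * _ = _
  have hn0 : groupX ω i + n i ≠ 0 := by linarith
  simp only [Finset.sum_const, Finset.card_univ, Fintype.card_fin, nsmul_eq_mul, mul_one]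
  have e : (groupX ω i + n i) * (b / (groupX ω i + n i)) ^ 2 = b ^ 2 / (groupX ω i + n i) := by
    field_simp
  rw [e]
  ring

theorem risk2_eq (δ : ((i : Fin m) → Fin (n i) → ℕ) → (Fin m → ℕ) → (i : Fin m) → Fin (n i) → ℝ)
    {lam : (i : Fin m) → Fin (n i) → ℝ} (hn : ∀ i, 4 ≤ n i) (hlam : ∀ i j, 0 < lam i j)
    (A : Fin m → ℝ → ℝ → ℝ)
    (hδ : ∀ (ω : CountIdx n → ℕ) i j, δ (countEquiv n ω).1 (countEquiv n ω).2 i j =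
      A i (groupX ω i + groupY ω i) (total ω) *
        ((ω (Sum.inl ⟨i, j⟩) : ℝ) / (groupX ω i + n i - 1)))
    (hA : ∀ i, PolyBdd fun ω : CountIdx n → ℕ => A i (groupX ω i + groupY ω i) (total ω)) :
    risk2 m n δ lam =
      ENNReal.ofReal (∑' ω, (∑ i, groupLoss lam (A i) i ω) * prodPmf (rates lam) ω) := by
  rw [ENNReal.ofReal_tsum_of_nonneg]
  · rw [risk2, ← ENNReal.tsum_prod
      (f := fun x y => ENNReal.ofReal ((∑ i, ∑ j, (δ x y i j - lam i j) ^ 2 / lam i j) *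
        jointPmf2 m n lam x y)), ← (countEquiv n).tsum_eq]
    refine tsum_congr fun ω => ?_
    rw [jointPmf2_countEquiv]
    simp only [hδ]
    rfl
  · exact fun ω => mul_nonneg (Finset.sum_nonneg fun i _ => Finset.sum_nonneg fun j _ =>
      div_nonneg (sq_nonneg _) (hlam i j).le) (prodPmf_pos (rates_pos hn hlam) ω).le
  · exact (PolyBdd.sum _ fun i _ => (hA i).groupLoss hn lam i).summable (rates_pos hn hlam)

end Groups

/-- Coefficient in the risk difference: `-2` times the difference of the scale factors of the
estimators `λ̂` and `λ^O`. -/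
noncomputable def scaleGap (m n z S : ℝ) : ℝ := z * (m - 1) / (S + m - 1) + (n - 1)

/-- Coefficient of `X_{i·} / (X_{i·} + n_i - 1)` in the risk difference. -/
noncomputable def shiftGap (m n z S : ℝ) : ℝ :=
  (((z + 1) / 2 * ((S + 1) / (S + m))) ^ 2 - ((z + n) / 2) ^ 2) / (z + n) + scaleGap m n z S

/-- The difference of the two group risks, after the Poisson shifts. -/
theorem shifted_loss_sub {m n X Y S : ℝ} (hm : 2 ≤ m) (hn : 4 ≤ n) (hX : 0 ≤ X) (hY : 0 ≤ Y)
    (hS : 0 ≤ S) (G : ℝ) :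
    (((S + 1) / 2 * ((X + Y + 1) / (S + 1 + m - 1))) ^ 2 / (X + n)
        - 2 * (S / 2 * ((X + Y) / (S + m - 1))) * X / (X + n - 1))
      - (((X + Y + 1 + n - 1) / 2) ^ 2 / (X + n) - 2 * ((X + Y + n - 1) / 2) * X / (X + n - 1)) =
    shiftGap m n (X + Y) S * (1 + X / (X + (n - 1)) - (X - Y) * G) - scaleGap m n (X + Y) S
      + (X * ((scaleGap m n (X + Y) S - shiftGap m n (X + Y) S) / (X + n - 1)
          + shiftGap m n (X + Y) S * G)
        - Y * ((scaleGap m n (X + Y) S - shiftGap m n (X + Y) S) / (X + 1 + n - 1)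
          + shiftGap m n (X + Y) S * G)) := by
  rw [show S + 1 + m - 1 = S + m by ring, show X + Y + 1 + n - 1 = X + Y + n by ring,
    show X + (n - 1) = X + n - 1 by ring, show X + 1 + n - 1 = X + n by ring]
  have e₁ : 2 * (S / 2 * ((X + Y) / (S + m - 1))) =
      X + Y + n - 1 - scaleGap m n (X + Y) S := by
    have : S + m - 1 ≠ 0 := by linarith
    unfold scaleGap
    field_simp
    ring
  have e₂ : ((S + 1) / 2 * ((X + Y + 1) / (S + m))) ^ 2 = ((X + Y + n) / 2) ^ 2 +
      (shiftGap m n (X + Y) S - scaleGap m n (X + Y) S) * (X + Y + n) := by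
    have : X + Y + n ≠ 0 := by linarith
    unfold shiftGap
    field_simp
    ring
  rw [e₁, e₂]
  have h₁ : X + n - 1 ≠ 0 := by linarith
  have h₂ : X + n ≠ 0 := by linarith
  field_simp
  ring

theorem PolyBdd.scaleGap {ι : Type*} [Fintype ι] {m n : ℝ} (hm : 2 ≤ m) {z S : (ι → ℕ) → ℝ}
    (hz : PolyBdd z) (hS : ∀ ω, 0 ≤ S ω) : PolyBdd fun ω => scaleGap m n (z ω) (S ω) :=
  ((hz.mul (const (m - 1))).div fun ω => by linarith [hS ω]).add (const (n - 1))

theorem PolyBdd.shiftGap {ι : Type*} [Fintype ι] {m n : ℝ} (hm : 2 ≤ m) (hn : 4 ≤ n)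
    {z S : (ι → ℕ) → ℝ} (hz : PolyBdd z) (hS : PolyBdd S) (hz0 : ∀ ω, 0 ≤ z ω)
    (hS0 : ∀ ω, 0 ≤ S ω) : PolyBdd fun ω => shiftGap m n (z ω) (S ω) := by
  have h2 : ∀ ω : ι → ℕ, (1 : ℝ) ≤ (fun _ => 2) ω := fun _ => one_le_two
  exact (((((((hz.add (const 1)).div h2).mul
    ((hS.add (const 1)).div fun ω => by linarith [hS0 ω])).pow 2).sub
    (((hz.add (const n)).div h2).pow 2)).div fun ω => by linarith [hz0 ω])).add
    (hz.scaleGap hm hS0)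

theorem NullMean.tsum_lt {ι : Type*} [Fintype ι] {θ : ι → ℝ} (hθ : ∀ a, 0 < θ a)
    {f g k : (ι → ℕ) → ℝ} (hf : PolyBdd f) (hg : PolyBdd g) (hk : ∀ ω, k ω < 0)
    (h : NullMean θ fun ω => f ω - g ω - k ω) :
    ∑' ω, f ω * prodPmf θ ω < ∑' ω, g ω * prodPmf θ ω := by
  have hks := ((hf.summable hθ).hasSum.sub (hg.summable hθ).hasSum).sub h
  have hlt := hasSum_lt (f := fun ω => k ω * prodPmf θ ω) (g := fun _ => 0) (i := 0)
    (fun ω => mul_nonpos_of_nonpos_of_nonneg (hk ω).le (prodPmf_pos hθ ω).le)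
    (mul_neg_of_neg_of_pos (hk 0) (prodPmf_pos hθ 0))
    ((congrArg (HasSum · _) (funext fun ω => by ring)).mp hks) hasSum_zero
  linarith

/- STATEMENT 13: if m ≥ 2, min_i n_i ≥ 4, and
(m−1)²/(2m) + (m−1)/m² + (2n_i−3)/m ≤ (n_i−1)(n_i−3)/2 for every i,
then λ̂ strictly dominates λ^O at every parameter point. -/
theorem stmt_13 (m : ℕ) (hm : 2 ≤ m) (n : Fin m → ℕ) (hn : ∀ i, 4 ≤ n i)
    (hineq : ∀ i, ((m : ℝ) - 1) ^ 2 / (2 * m) + ((m : ℝ) - 1) / (m : ℝ) ^ 2 +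
        (2 * (n i : ℝ) - 3) / m ≤ ((n i : ℝ) - 1) * ((n i : ℝ) - 3) / 2)
    (lam : (i : Fin m) → Fin (n i) → ℝ) (hlam : ∀ i j, 0 < lam i j) :
    risk2 m n (estHat2 m n) lam < risk2 m n (estO2 m n) lam := by
  have hm' : (2 : ℝ) ≤ m := by exact_mod_cast hm
  have hn' : ∀ i, (4 : ℝ) ≤ n i := fun i => by exact_mod_cast hn i
  have hθ := rates_pos hn hlam
  have hz : ∀ i, PolyBdd fun ω : CountIdx n → ℕ => groupX ω i + groupY ω i := fun i =>
    (polyBdd_groupX i).add (polyBdd_groupY i)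
  have hz0 : ∀ (i) (ω : CountIdx n → ℕ), 0 ≤ groupX ω i + groupY ω i := fun i ω =>
    add_nonneg (groupX_nonneg ω i) (groupY_nonneg ω i)
  have h2 : ∀ ω : CountIdx n → ℕ, (1 : ℝ) ≤ (fun _ => 2) ω := fun _ => one_le_two
  let AO : Fin m → ℝ → ℝ → ℝ := fun i z _ => (z + n i - 1) / 2
  let AH : Fin m → ℝ → ℝ → ℝ := fun _ z S => S / 2 * (z / (S + m - 1))
  have hAO : ∀ i, PolyBdd fun ω : CountIdx n → ℕ => AO i (groupX ω i + groupY ω i) (total ω) :=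
    fun i => (((hz i).add (PolyBdd.const _)).sub (PolyBdd.const _)).div h2
  have hAH : ∀ i, PolyBdd fun ω : CountIdx n → ℕ => AH i (groupX ω i + groupY ω i) (total ω) :=
    fun i => (polyBdd_total.div h2).mul ((hz i).div fun ω => by linarith [total_nonneg ω])
  rw [risk2_eq (estHat2 m n) hn hlam AH
      (fun ω i j => by simp only [AH, total_eq]; rfl) hAH,
    risk2_eq (estO2 m n) hn hlam AO (fun ω i j => rfl) hAO]
  let G : Fin m → ℝ → ℝ := fun i z => 2 * (n i - 1) / (z + 2 * (n i - 1)) ^ 2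
  let F : Fin m → (CountIdx n → ℕ) → ℝ := fun i ω =>
    shiftGap m (n i) (groupX ω i + groupY ω i) (total ω)
  let B : Fin m → (CountIdx n → ℕ) → ℝ := fun i ω =>
    scaleGap m (n i) (groupX ω i + groupY ω i) (total ω)
  let T : Fin m → (CountIdx n → ℕ) → ℝ := fun i ω => F i ω * (1 +
    groupX ω i / (groupX ω i + (n i - 1)) -
      (groupX ω i - groupY ω i) * G i (groupX ω i + groupY ω i)) - B i ω
  have hB : ∀ i, PolyBdd (B i) := fun i => (hz i).scaleGap hm' total_nonneg
  have hF : ∀ i, PolyBdd (F i) := fun i =>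
    (hz i).shiftGap hm' (hn' i) polyBdd_total (hz0 i) total_nonneg
  have hG : ∀ i, PolyBdd fun ω : CountIdx n → ℕ => G i (groupX ω i + groupY ω i) := fun i =>
    (PolyBdd.const _).div fun ω => one_le_pow₀ (by linarith [hz0 i ω, hn' i])
  have hT : ∀ ω, ∑ i, T i ω < 0 := fun ω => by
    refine (Finset.sum_le_sum fun i _ => ?_).trans_lt
      (sum_group_bound_neg hm (hz0 · ω) (total_eq_sum_group ω))
    have hz1 : groupX ω i + groupY ω i = 0 ∨ 1 ≤ groupX ω i + groupY ω i := by
      have e : groupX ω i + groupY ω i =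
          ((∑ j, ω (Sum.inl ⟨i, j⟩) + ω (Sum.inr i) : ℕ) : ℝ) := by
        push_cast
        rfl
      rw [e]
      exact_mod_cast Nat.eq_zero_or_pos _
    obtain ⟨hF0, hb⟩ := group_bound hm' (hn' i) hz1 (group_le_total ω i) (B := B i ω)
      (F := F i ω) rfl rfl
    have ht := div_le_tangent (c := n i - 1) (by linarith [hn' i]) (groupX_nonneg ω i)
      (groupY_nonneg ω i)
    have := mul_le_mul_of_nonneg_left ht hF0
    change F i ω * (1 + groupX ω i / (groupX ω i + (n i - 1)) - (groupX ω i - groupY ω i) *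
      (2 * (n i - 1) / (groupX ω i + groupY ω i + 2 * (n i - 1)) ^ 2)) - B i ω ≤ _
    linarith
  have hnull := NullMean.sum Finset.univ fun i _ =>
    (((nullMean_groupLoss hn hlam (AH i) i (hAH i)).sub
      (nullMean_groupLoss hn hlam (AO i) i (hAO i))).add
    (nullMean_swap hθ i
      (fun X z S => (scaleGap m (n i) z S - shiftGap m (n i) z S) / (X + n i - 1) +
        shiftGap m (n i) z S * G i z)
      ((((hB i).sub (hF i)).div fun ω => by linarith [groupX_nonneg ω i, hn' i]).add
        ((hF i).mul (hG i)))
      ((((hB i).sub (hF i)).div fun ω => by linarith [groupX_nonneg ω i, hn' i]).add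
        ((hF i).mul (hG i)))))
  have hlt := NullMean.tsum_lt hθ (PolyBdd.sum _ fun i _ => (hAH i).groupLoss hn lam i)
    (PolyBdd.sum _ fun i _ => (hAO i).groupLoss hn lam i) hT
    ((congrArg (NullMean (rates lam)) (funext fun ω => by
      rw [← Finset.sum_sub_distrib, ← Finset.sum_sub_distrib]
      refine Finset.sum_congr rfl fun i _ => ?_
      have h := shifted_loss_sub hm' (hn' i) (groupX_nonneg ω i) (groupY_nonneg ω i)
        (total_nonneg ω) (G i (groupX ω i + groupY ω i))
      simp only [AH, AO, T, F, B]
      linarith)).mp hnull)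
  refine (ENNReal.ofReal_lt_ofReal_iff (lt_of_le_of_lt ?_ hlt)).2 hlt
  exact tsum_nonneg fun ω => mul_nonneg (Finset.sum_nonneg fun i _ => Finset.sum_nonneg fun j _ =>
    div_nonneg (sq_nonneg _) (hlam i j).le) (prodPmf_pos hθ ω).le
end
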